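/- Let A be the weighted adjacency matrix of an undirected weighted graph without loops, D the diagonal matrix of row sums, and B = D + A the signless Laplacian. Let S₁, …, S_p be pairwise disjoint subsets of vertices, with |S_t| = m_t ≥ 2, such that each S_t carries an (m_t,k_t,s_t)-star with central weight a_t and weight w_t, and suppose w_t − a_t = λ for all t. Then λ is an eigenvalue of B and the eigenspace ker(B − λ·I) has dimension at least Σ_{t=1}^{p} (m_t − 1). -/

import Mathlib

/-- If `i ≠ j` are vertices of equal weight `w` in a loopless graph having the same adjacencies
outside `{i, j}`, then `e_i - e_j` is an eigenvector of the signless Laplacian for the value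
`w - A i j`. -/
theorem single_sub_single_mem_eigenspace {ι : Type*} [Fintype ι] [DecidableEq ι]
    {A : Matrix ι ι ℝ} (hsymm : A.IsSymm) (hdiag : ∀ i, A i i = 0) {i j : ι} (hij : i ≠ j)
    {w : ℝ} (hi : ∑ l, A i l = w) (hj : ∑ l, A j l = w)
    (htwin : ∀ l, l ≠ i → l ≠ j → A i l = A j l) :
    (Pi.single i 1 - Pi.single j 1 : ι → ℝ) ∈
      Module.End.eigenspace
        (Matrix.toLin' (Matrix.diagonal (fun i => ∑ l, A i l) + A)) (w - A i j) := by
  rw [Module.End.mem_eigenspace_iff]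
  ext l
  simp only [Matrix.toLin'_apply, Matrix.mulVec_sub, Matrix.mulVec_single_one,
    Pi.sub_apply, Pi.smul_apply, smul_eq_mul, Matrix.col_apply]
  by_cases hli : l = i
  · subst hli
    simp [hij, hdiag, hi]
  by_cases hlj : l = j
  · subst hlj
    simp [hij.symm, hdiag, hj, hsymm.apply i l]
  · have h := htwin l hli hlj
    rw [← hsymm.apply, ← hsymm.apply j] at h
    simp [hli, hlj, h]

/-- Given sets `T t` and points `r t'` avoiding all the `T t`, with the `T t` pairwise disjoint,
the vectors `e_i - e_{r t}` for `i ∈ T t` are linearly independent. -/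
theorem linearIndependent_single_sub_single {ι τ : Type*} [DecidableEq ι] [Fintype τ]
    (T : τ → Finset ι) (r : τ → ι) (hr : ∀ t t', r t' ∉ T t)
    (hdisj : ∀ t t', t ≠ t' → Disjoint (T t) (T t')) :
    LinearIndependent ℝ
      (fun x : Σ t, T t => (Pi.single (x.2 : ι) 1 - Pi.single (r x.1) 1 : ι → ℝ)) := by
  classical
  rw [Fintype.linearIndependent_iff]
  intro c hc x
  have h := congrFun hc x.2
  rw [Finset.sum_apply, Finset.sum_eq_single x] at h
  · have hne : (x.2 : ι) ≠ r x.1 := fun h => hr x.1 x.1 (h ▸ x.2.2)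
    simpa [hne] using h
  · intro y _ hyx
    have hne : (x.2 : ι) ≠ r y.1 := fun h => hr x.1 y.1 (h ▸ x.2.2)
    have hne' : (x.2 : ι) ≠ y.2 := by
      obtain ⟨t, i, hi⟩ := x
      obtain ⟨t', i', hi'⟩ := y
      rintro rfl
      by_cases htt : t = t'
      · subst htt
        exact hyx rfl
      · exact Finset.disjoint_left.mp (hdisj t t' htt) hi hi'
    simp [hne, hne']
  · simp


/-- If pairwise disjoint subsets `S t` (each of size `m t ≥ 2`) of a loopless
weighted graph each carry an `(m_t,k_t,s_t)`-star with central weight `a t` and weight `w t`,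
and `w t - a t = lam` for all `t`, then `lam` is an eigenvalue of the signless Laplacian
`B = D + A` with eigenspace of dimension at least `∑ (m t - 1)`. -/
theorem stmt_4 {n p : ℕ} (hp : 0 < p) (A : Matrix (Fin n) (Fin n) ℝ)
    (hsymm : A.IsSymm)
    (hnonneg : ∀ i j, 0 ≤ A i j)
    (hdiag : ∀ i, A i i = 0)
    (D B : Matrix (Fin n) (Fin n) ℝ)
    (hD : D = Matrix.diagonal (fun i => ∑ j, A i j))
    (hB : B = D + A)
    (S : Fin p → Finset (Fin n)) (m : Fin p → ℕ)
    (hm : ∀ t, 2 ≤ m t) (hcard : ∀ t, (S t).card = m t)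
    (hdisj : ∀ t t', t ≠ t' → Disjoint (S t) (S t'))
    (a w : Fin p → ℝ) (ha : ∀ t, 0 ≤ a t)
    (hstar_center : ∀ t, ∀ i ∈ S t, ∀ j ∈ S t, i ≠ j → A i j = a t)
    (hstar_out : ∀ t, ∀ i ∈ S t, ∀ j ∈ S t, ∀ l, l ∉ S t → A i l = A j l)
    (hw : ∀ t, ∀ i ∈ S t, ∑ l, A i l = w t)
    (lam : ℝ) (hlam : ∀ t, w t - a t = lam) :
    Module.End.HasEigenvalue (Matrix.toLin' B) lam ∧
    (∑ t, (m t - 1)) ≤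
      Module.finrank ℝ (Module.End.eigenspace (Matrix.toLin' B) lam) := by
  have hne : ∀ t, (S t).Nonempty := fun t =>
    Finset.card_pos.mp (by have := hm t; have := hcard t; omega)
  choose r hr using hne
  have hrT : ∀ t t', r t' ∉ (S t).erase (r t) := by
    intro t t' h
    rw [Finset.mem_erase] at h
    by_cases htt : t = t'
    · exact h.1 (by rw [htt])
    · exact Finset.disjoint_left.mp (hdisj t t' htt) h.2 (hr t')
  have hind := linearIndependent_single_sub_single (fun t => (S t).erase (r t)) r hrT
    fun t t' htt => (hdisj t t' htt).mono (Finset.erase_subset _ _) (Finset.erase_subset _ _)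
  have hmem : ∀ x : Σ t, (S t).erase (r t),
      (Pi.single (x.2 : Fin n) 1 - Pi.single (r x.1) 1 : Fin n → ℝ) ∈
        Module.End.eigenspace (Matrix.toLin' B) lam := by
    rintro ⟨t, i, hi⟩
    obtain ⟨hir, hiS⟩ := Finset.mem_erase.mp hi
    have htwin : ∀ l, l ≠ i → l ≠ r t → A i l = A (r t) l := by
      intro l hli hlr
      by_cases hl : l ∈ S t
      · rw [hstar_center t i hiS l hl hli.symm, hstar_center t _ (hr t) l hl hlr.symm]
      · exact hstar_out t i hiS _ (hr t) l hl
    have h := single_sub_single_mem_eigenspace hsymm hdiag hir (hw t i hiS) (hw t _ (hr t)) htwin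
    rwa [hstar_center t i hiS _ (hr t) hir, hlam t, ← hD, ← hB] at h
  have hdim : (∑ t, (m t - 1)) ≤
      Module.finrank ℝ (Module.End.eigenspace (Matrix.toLin' B) lam) := by
    have hsub : LinearIndependent ℝ (fun x : Σ t, (S t).erase (r t) =>
        (⟨_, hmem x⟩ : Module.End.eigenspace (Matrix.toLin' B) lam)) :=
      LinearIndependent.of_comp (Submodule.subtype _) hind
    have h := hsub.fintype_card_le_finrank
    simpa only [Fintype.card_sigma, Fintype.card_coe, Finset.card_erase_of_mem (hr _), hcard]
      using h
  refine ⟨fun hbot => ?_, hdim⟩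
  have hzero : Module.finrank ℝ (Module.End.eigenspace (Matrix.toLin' B) lam) = 0 := by
    rw [Module.End.eigenspace, hbot, finrank_bot]
  have hle := Finset.single_le_sum (f := fun t => m t - 1) (fun _ _ => Nat.zero_le _)
    (Finset.mem_univ (⟨0, hp⟩ : Fin p))
  have := hm ⟨0, hp⟩
  omega
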